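/- Let 𝒞 be a staged tree whose underlying tree is a caterpillar, i.e. it has exactly one non-leaf vertex at each level 0,…,d−1. Then ker φ_𝒞 contains no nonzero linear form: no nontrivial ℝ-linear combination ∑_i a_i·p_i of the variables p₁,…,p_n lies in the kernel of the parametrisation map φ_𝒞 : ℝ[p₁,…,p_n] → ℝ[Θ]/⟨θ−1⟩. -/

import Mathlib

noncomputable section
open scoped Classical
open MvPolynomial

/-- A staged tree: a finite rooted tree with edges directed away from the root,
each non-root vertex `c` carrying the label `label c` of the edge from `parent c` to `c`;
labels of outgoing edges of a vertex are pairwise distinct, and the outgoing label sets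
of two vertices are either equal (same stage) or disjoint. -/
structure StagedTree (Θ : Type) [DecidableEq Θ] : Type 1 where
  V : Type
  fintypeV : Fintype V
  decEqV : DecidableEq V
  root : V
  parent : V → V
  label : V → Θ
  parent_root : parent root = root
  reaches_root : ∀ v : V, ∃ n : ℕ, parent^[n] v = root
  label_inj : ∀ u v : V, u ≠ root → v ≠ root → parent u = parent v → label u = label v → u = v
  stage_disjoint : ∀ u v : V,
    (∀ θ : Θ, (∃ c, c ≠ root ∧ parent c = u ∧ label c = θ) ↔
        (∃ c, c ≠ root ∧ parent c = v ∧ label c = θ)) ∨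
    (∀ θ : Θ, ¬((∃ c, c ≠ root ∧ parent c = u ∧ label c = θ) ∧
        (∃ c, c ≠ root ∧ parent c = v ∧ label c = θ)))

namespace StagedTree

attribute [instance] StagedTree.fintypeV StagedTree.decEqV

variable {Θ : Type} [DecidableEq Θ] (T : StagedTree Θ)

/-- `c` is a child of `v`. -/
def IsChild (v c : T.V) : Prop := c ≠ T.root ∧ T.parent c = v

/-- `v` is a leaf (no children). -/
def IsLeaf (v : T.V) : Prop := ∀ c, ¬ T.IsChild v c

/-- `w` lies in the subtree rooted at `v` (i.e. `v` is an ancestor of `w` or `w` itself). -/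
def Desc (v w : T.V) : Prop := ∃ n : ℕ, T.parent^[n] w = v

/-- Distance of `v` from the root. -/
def depthOf (v : T.V) : ℕ := Nat.find (T.reaches_root v)

/-- The depth `d` of the tree: maximal number of edges on a root-to-leaf path. -/
def depth : ℕ := Finset.univ.sup T.depthOf

/-- The type of leaves of `T`. -/
def Leaf : Type := {v : T.V // T.IsLeaf v}

instance : Fintype T.Leaf := Subtype.fintype _

/-- Product of the labels along the root-to-`v` path, in `ℝ[Θ]`. -/
def pathProd (v : T.V) : MvPolynomial Θ ℝ :=
  ∏ i ∈ Finset.range (T.depthOf v), X (T.label (T.parent^[i] v))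

/-- Homogenised root-to-`v` path monomial `z^(d - d(λ)) ∏ θ(e)` in `ℝ[Θ, z]`,
where the variable `none` plays the role of `z`. -/
def hpm (v : T.V) : MvPolynomial (Option Θ) ℝ :=
  (X none) ^ (T.depth - T.depthOf v) *
    ∏ i ∈ Finset.range (T.depthOf v), X (some (T.label (T.parent^[i] v)))

/-- The ideal `⟨θ - z⟩` of homogenised local sum-to-one conditions. -/
def sumIdeal : Ideal (MvPolynomial (Option Θ) ℝ) :=
  Ideal.span {f | ∃ v : T.V, ¬ T.IsLeaf v ∧
    f = (∑ c ∈ Finset.univ.filter (fun c => T.IsChild v c), X (some (T.label c))) - X none}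

/-- The homogenised parametrisation `φ_T : ℝ[p] → ℝ[Θ, z]/⟨θ - z⟩`. -/
def phi : MvPolynomial T.Leaf ℝ →ₐ[ℝ] MvPolynomial (Option Θ) ℝ ⧸ T.sumIdeal :=
  aeval (fun l : T.Leaf => Ideal.Quotient.mk T.sumIdeal (T.hpm l.1))

/-- The ideal `⟨θ - 1⟩` of local sum-to-one conditions. -/
def oneIdeal : Ideal (MvPolynomial Θ ℝ) :=
  Ideal.span {f | ∃ v : T.V, ¬ T.IsLeaf v ∧
    f = (∑ c ∈ Finset.univ.filter (fun c => T.IsChild v c), X (T.label c)) - 1}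

/-- The (non-homogenised) parametrisation `φ_T : ℝ[p] → ℝ[Θ]/⟨θ - 1⟩`. -/
def phi1 : MvPolynomial T.Leaf ℝ →ₐ[ℝ] MvPolynomial Θ ℝ ⧸ T.oneIdeal :=
  aeval (fun l : T.Leaf => Ideal.Quotient.mk T.oneIdeal (T.pathProd l.1))

/-- The subtree polynomial `t(v)`: sum over all `v`-to-leaf paths of the products of
edge labels along the path. -/
def tpoly (v : T.V) : MvPolynomial Θ ℝ :=
  ∑ l ∈ Finset.univ.filter (fun w => T.IsLeaf w ∧ T.Desc v w),
    ∏ i ∈ Finset.range (T.depthOf l - T.depthOf v), X (T.label (T.parent^[i] l))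

/-- Two non-leaf vertices are in the same stage when their outgoing label sets coincide. -/
def SameStage (u v : T.V) : Prop :=
  ¬ T.IsLeaf u ∧ ¬ T.IsLeaf v ∧
    ∀ θ : Θ, (∃ c, T.IsChild u c ∧ T.label c = θ) ↔ (∃ c, T.IsChild v c ∧ T.label c = θ)

/-- `T` is balanced: `t(u_i)·t(v_j) = t(u_j)·t(v_i)` for all `u ∼ v` and all pairs of
children matched via the common labels. -/
def Balanced : Prop :=
  ∀ u v ui uj vi vj : T.V, T.SameStage u v →
    T.IsChild u ui → T.IsChild u uj → T.IsChild v vi → T.IsChild v vj →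
    T.label ui = T.label vi → T.label uj = T.label vj →
    T.tpoly ui * T.tpoly vj = T.tpoly uj * T.tpoly vi

/-- `p_{[v]}`: sum of the variables `p_r` over root-to-leaf paths through `v`. -/
def pSum (v : T.V) : MvPolynomial T.Leaf ℝ :=
  ∑ l ∈ Finset.univ.filter (fun l : T.Leaf => T.Desc v l.1), X l

/-- `T` has toric structure: there are linearly independent linear forms in which
`ker φ_T` is generated by binomials. -/
def Toric : Prop :=
  ∃ L : T.Leaf → MvPolynomial T.Leaf ℝ,
    (∀ i, (L i).IsHomogeneous 1) ∧ LinearIndependent ℝ L ∧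
    ∃ B : Set (MvPolynomial T.Leaf ℝ),
      (∀ f ∈ B, ∃ a b : T.Leaf → ℕ, f = (∏ i, L i ^ a i) - (∏ i, L i ^ b i)) ∧
      RingHom.ker T.phi.toRingHom = Ideal.span B

end StagedTree

namespace StagedTree

variable {Θ : Type} [DecidableEq Θ] (T : StagedTree Θ)

lemma depthOf_root : T.depthOf T.root = 0 := by
  simp [depthOf]

lemma depthOf_eq_zero {v : T.V} : T.depthOf v = 0 ↔ v = T.root := by
  simp [depthOf]

lemma depthOf_parent (v : T.V) : T.depthOf (T.parent v) = T.depthOf v - 1 := by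
  by_cases hv : v = T.root
  · simp [hv, T.parent_root, depthOf_root]
  · have h : T.depthOf v = T.depthOf (T.parent v) + 1 :=
      Nat.find_comp_succ (T.reaches_root v) (T.reaches_root (T.parent v)) (by simpa using hv)
    omega

lemma depthOf_iterate_parent (k : ℕ) (v : T.V) :
    T.depthOf (T.parent^[k] v) = T.depthOf v - k := by
  induction k with
  | zero => simp
  | succ k ih => rw [Function.iterate_succ_apply', depthOf_parent, ih]; omega

lemma isChild_iterate_parent {k : ℕ} {v : T.V} (hk : k < T.depthOf v) :
    T.IsChild (T.parent^[k + 1] v) (T.parent^[k] v) := by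
  refine ⟨fun h => ?_, (Function.iterate_succ_apply' _ _ _).symm⟩
  have := T.depthOf_iterate_parent k v
  rw [h, depthOf_root] at this
  omega

/-- The set of labels of the outgoing edges of `v`. -/
def outLabels (v : T.V) : Finset Θ :=
  (Finset.univ.filter fun c => T.IsChild v c).image T.label

lemma mem_outLabels {v : T.V} {θ : Θ} :
    θ ∈ T.outLabels v ↔ ∃ c, T.IsChild v c ∧ T.label c = θ := by
  simp [outLabels]

lemma outLabels_eq_or_disjoint (u v : T.V) :
    T.outLabels u = T.outLabels v ∨ Disjoint (T.outLabels u) (T.outLabels v) := by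
  rcases T.stage_disjoint u v with h | h
  · left
    ext θ
    simpa [mem_outLabels, IsChild, and_assoc] using h θ
  · right
    rw [Finset.disjoint_left]
    intro θ hu hv
    refine h θ ⟨?_, ?_⟩
    · simpa [mem_outLabels, IsChild, and_assoc] using hu
    · simpa [mem_outLabels, IsChild, and_assoc] using hv

lemma label_eq_iff {v b c : T.V} (hb : T.IsChild v b) (hc : T.IsChild v c) :
    T.label b = T.label c ↔ b = c :=
  ⟨T.label_inj b c hb.1 hc.1 (hb.2.trans hc.2.symm), fun h => h ▸ rfl⟩

lemma sum_outLabels {M : Type*} [AddCommMonoid M] (v : T.V) (f : Θ → M) :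
    ∑ θ ∈ T.outLabels v, f θ =
      ∑ c ∈ Finset.univ.filter (fun c => T.IsChild v c), f (T.label c) := by
  refine Finset.sum_image fun b hb c hc h => ?_
  simp only [Finset.coe_filter, Finset.mem_univ, true_and, Set.mem_ofPred_eq] at hb hc
  exact (T.label_eq_iff hb hc).1 h

/-- Parameter vectors satisfying all local sum-to-one conditions. -/
def SumsToOne (x : Θ → ℝ) : Prop :=
  ∀ v, ¬ T.IsLeaf v → ∑ θ ∈ T.outLabels v, x θ = 1

/-- The real zeros of `oneIdeal` evaluate to zeros of every form in the kernel. -/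
lemma sum_eq_zero_of_phi1_eq_zero {a : T.Leaf → ℝ}
    (h : T.phi1 (∑ r : T.Leaf, C (a r) * X r) = 0) {x : Θ → ℝ} (hx : T.SumsToOne x) :
    ∑ r : T.Leaf, a r *
      ∏ i ∈ Finset.range (T.depthOf r.1), x (T.label (T.parent^[i] r.1)) = 0 := by
  have hmem : ∑ r : T.Leaf, C (a r) * T.pathProd r.1 ∈ T.oneIdeal := by
    rw [← Ideal.Quotient.eq_zero_iff_mem, ← h]
    simp only [phi1, map_sum, map_mul, aeval_X, algHom_C]
    rfl
  have hle : T.oneIdeal ≤ RingHom.ker (eval x) := by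
    refine Ideal.span_le.2 ?_
    rintro f ⟨v, hv, rfl⟩
    simp [RingHom.mem_ker, ← T.sum_outLabels v x, hx v hv]
  simpa [RingHom.mem_ker, pathProd] using hle hmem

lemma outLabels_nonempty {v : T.V} (hv : ¬ T.IsLeaf v) : (T.outLabels v).Nonempty := by
  simp only [IsLeaf, not_forall, not_not] at hv
  obtain ⟨c, hc⟩ := hv
  exact ⟨T.label c, T.mem_outLabels.2 ⟨c, hc, rfl⟩⟩

lemma exists_pos_sumsToOne : ∃ x : Θ → ℝ, T.SumsToOne x ∧ ∀ θ, 0 < x θ := by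
  refine ⟨fun θ => if hθ : ∃ v, θ ∈ T.outLabels v then
    ((T.outLabels hθ.choose).card : ℝ)⁻¹ else 1, fun v hv => ?_, fun θ => ?_⟩
  · have hcard : ((T.outLabels v).card : ℝ) ≠ 0 :=
      Nat.cast_ne_zero.2 (T.outLabels_nonempty hv).card_ne_zero
    have hconst : ∀ θ ∈ T.outLabels v, (if hθ : ∃ v, θ ∈ T.outLabels v then
        ((T.outLabels hθ.choose).card : ℝ)⁻¹ else 1) = ((T.outLabels v).card : ℝ)⁻¹ := by
      intro θ hmem
      have hθ : ∃ v, θ ∈ T.outLabels v := ⟨v, hmem⟩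
      rw [dif_pos hθ]
      rcases T.outLabels_eq_or_disjoint hθ.choose v with he | hd
      · rw [he]
      · exact absurd hmem (Finset.disjoint_left.1 hd hθ.choose_spec)
    rw [Finset.sum_congr rfl hconst, Finset.sum_const, nsmul_eq_mul, mul_inv_cancel₀ hcard]
  · dsimp only
    split_ifs with hθ
    · exact inv_pos.2 (Nat.cast_pos.2 (Finset.card_pos.2 ⟨θ, hθ.choose_spec⟩))
    · exact one_pos

/-- There are nonnegative parameters concentrating a stage on any one of its labels. -/
lemma exists_nonneg_sumsToOne {v c : T.V} (hc : T.IsChild v c) :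
    ∃ y : Θ → ℝ, T.SumsToOne y ∧ (∀ θ, 0 ≤ y θ) ∧ y (T.label c) = 1 ∧
      ∀ θ ∈ T.outLabels v, θ ≠ T.label c → y θ = 0 := by
  obtain ⟨u, hu, hpos⟩ := T.exists_pos_sumsToOne
  have hmem : T.label c ∈ T.outLabels v := T.mem_outLabels.2 ⟨c, hc, rfl⟩
  refine ⟨fun θ => if θ ∈ T.outLabels v then if θ = T.label c then 1 else 0 else u θ,
    fun w hw => ?_, fun θ => ?_, ?_, fun θ hθ hne => ?_⟩
  · rcases T.outLabels_eq_or_disjoint w v with he | hd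
    · rw [he, Finset.sum_congr rfl fun θ hθ => if_pos hθ]
      simp [hmem]
    · rw [Finset.sum_congr rfl fun θ hθ => if_neg (Finset.disjoint_left.1 hd hθ), hu w hw]
  · dsimp only
    split_ifs
    · exact zero_le_one
    · exact le_rfl
    · exact (hpos θ).le
  · simp [hmem]
  · simp [hθ, hne]

lemma SumsToOne.lineMap {x y : Θ → ℝ} (hx : T.SumsToOne x) (hy : T.SumsToOne y) (t : ℝ) :
    T.SumsToOne fun θ => (1 - t) * x θ + t * y θ := by
  intro v hv
  rw [Finset.sum_add_distrib, ← Finset.mul_sum, ← Finset.mul_sum, hx v hv, hy v hv]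
  ring

/-- A continuous function vanishing at the positive sum-to-one parameters vanishes at the
nonnegative ones. -/
lemma eq_zero_of_forall_pos {G : (Θ → ℝ) → ℝ} (hG : Continuous G)
    (h : ∀ x, T.SumsToOne x → (∀ θ, 0 < x θ) → G x = 0)
    {y : Θ → ℝ} (hy : T.SumsToOne y) (hy0 : ∀ θ, 0 ≤ y θ) : G y = 0 := by
  obtain ⟨u, hu, hpos⟩ := T.exists_pos_sumsToOne
  let γ : ℝ → ℝ := fun t => G fun θ => (1 - t) * y θ + t * u θ
  have hγ : Continuous γ := hG.comp (by fun_prop)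
  have hγ0 : Set.EqOn γ 0 (Set.Ioo 0 1) := fun t ht =>
    h _ (hy.lineMap T hu t) fun θ =>
      add_pos_of_nonneg_of_pos (mul_nonneg (sub_nonneg.2 ht.2.le) (hy0 θ)) (mul_pos ht.1 (hpos θ))
  have hcl := hγ0.closure hγ continuous_const
  rw [closure_Ioo zero_ne_one] at hcl
  simpa [γ] using hcl (Set.left_mem_Icc.2 zero_le_one)

/-- In a caterpillar, the path to a deeper vertex passes through every non-leaf vertex of smaller
depth. -/
lemma iterate_parent_eq
    (hcat : ∀ u v : T.V, ¬ T.IsLeaf u → ¬ T.IsLeaf v → T.depthOf u = T.depthOf v → u = v)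
    {v w : T.V} (hv : ¬ T.IsLeaf v) (hw : T.depthOf v < T.depthOf w) :
    T.parent^[T.depthOf w - T.depthOf v] w = v := by
  refine hcat _ _ (fun hl => ?_) hv (by rw [depthOf_iterate_parent]; omega)
  obtain ⟨k, hk⟩ : ∃ k, T.depthOf w - T.depthOf v = k + 1 :=
    ⟨_, (Nat.sub_add_cancel (by omega)).symm⟩
  rw [hk] at hl
  exact hl _ (T.isChild_iterate_parent (by omega))

/-- If `𝒞` is a caterpillar staged tree (at most one non-leaf vertex at
each level, hence exactly one at each level `0,…,d−1`), then `ker φ_𝒞` contains no nonzero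
linear form: any ℝ-linear combination of the variables lying in the kernel of
`φ_𝒞 : ℝ[p] → ℝ[Θ]/⟨θ−1⟩` is trivial. -/
theorem caterpillar_no_linear_relations
    (hcat : ∀ u v : T.V, ¬ T.IsLeaf u → ¬ T.IsLeaf v → T.depthOf u = T.depthOf v → u = v)
    (a : T.Leaf → ℝ)
    (h : T.phi1 (∑ r : T.Leaf, MvPolynomial.C (a r) * MvPolynomial.X r) = 0) :
    ∀ r, a r = 0 := by
  suffices H : ∀ n, ∀ r : T.Leaf, T.depthOf r.1 = n → a r = 0 from fun r => H _ r rfl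
  intro n
  induction n using Nat.strong_induction_on with
  | _ n ih =>
  intro r hr
  rcases Nat.eq_zero_or_pos n with rfl | hn
  · obtain ⟨u, hu, -⟩ := T.exists_pos_sumsToOne
    have hroot := T.depthOf_eq_zero.1 hr
    have hsub : ∀ s : T.Leaf, s = r := by
      intro s
      by_contra hne
      have hpos : 0 < T.depthOf s.1 := Nat.pos_of_ne_zero fun h0 =>
        hne (Subtype.ext ((T.depthOf_eq_zero.1 h0).trans hroot.symm))
      have hchild := T.isChild_iterate_parent (Nat.sub_one_lt_of_lt hpos)
      rw [Nat.sub_add_cancel hpos, T.depthOf_eq_zero.1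
        ((T.depthOf_iterate_parent (T.depthOf s.1) s.1).trans (Nat.sub_self _)), ← hroot] at hchild
      exact r.2 _ hchild
    have hsum := T.sum_eq_zero_of_phi1_eq_zero h hu
    rw [Finset.sum_eq_single r (fun s _ hs => absurd (hsub s) hs) (by simp), hr] at hsum
    simpa using hsum
  · obtain ⟨v, hv⟩ : ∃ v, v = T.parent r.1 := ⟨_, rfl⟩
    have hrv : T.IsChild v r.1 :=
      ⟨fun h0 => by rw [h0, depthOf_root] at hr; omega, hv.symm⟩
    have hvleaf : ¬ T.IsLeaf v := fun hl => hl _ hrv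
    have hdv : T.depthOf v + 1 = n := by rw [hv, depthOf_parent]; omega
    let Q : T.Leaf → (Θ → ℝ) → ℝ := fun s x =>
      ∏ i ∈ Finset.range (T.depthOf s.1 - T.depthOf v), x (T.label (T.parent^[i] s.1))
    have hfactor : ∀ (x : Θ → ℝ) (s : T.Leaf), a s *
        ∏ i ∈ Finset.range (T.depthOf s.1), x (T.label (T.parent^[i] s.1)) =
        a s * Q s x * ∏ i ∈ Finset.range (T.depthOf v), x (T.label (T.parent^[i] v)) := by
      intro x s
      by_cases hs : T.depthOf s.1 < n
      · simp [ih _ hs s rfl]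
      · have hlt : T.depthOf v < T.depthOf s.1 := by omega
        have hit := T.iterate_parent_eq hcat hvleaf hlt
        obtain ⟨k, hk⟩ := Nat.exists_eq_add_of_le' hlt.le
        simp only [Q]
        rw [hk, Nat.add_sub_cancel] at hit
        rw [hk, Nat.add_sub_cancel, Finset.prod_range_add, mul_assoc]
        simp only [Nat.add_comm k, Function.iterate_add_apply, hit]
    have hG : Continuous fun x : Θ → ℝ => ∑ s : T.Leaf, a s * Q s x := by
      simp only [Q]
      fun_prop
    obtain ⟨y, hy, hy0, hy1, hyz⟩ := T.exists_nonneg_sumsToOne hrv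
    have hGy := T.eq_zero_of_forall_pos hG (fun x hx hpos => by
      have hsum := T.sum_eq_zero_of_phi1_eq_zero h hx
      rw [Finset.sum_congr rfl fun s _ => hfactor x s, ← Finset.sum_mul] at hsum
      exact (mul_eq_zero.1 hsum).resolve_right
        (Finset.prod_pos fun i _ => hpos _).ne') hy hy0
    have hQr : Q r y = 1 := by
      have hone : T.depthOf r.1 - T.depthOf v = 1 := by omega
      simp [Q, hone, hy1]
    rw [Finset.sum_eq_single r _ (by simp), hQr, mul_one] at hGy
    · exact hGy
    intro s _ hsr
    by_cases hs : T.depthOf s.1 < n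
    · simp [ih _ hs s rfl]
    have hlt : T.depthOf v < T.depthOf s.1 := by omega
    have hit := T.iterate_parent_eq hcat hvleaf hlt
    obtain ⟨k, hk⟩ : ∃ k, T.depthOf s.1 - T.depthOf v = k + 1 :=
      ⟨_, (Nat.sub_add_cancel (by omega)).symm⟩
    have hchild := T.isChild_iterate_parent (show k < T.depthOf s.1 by omega)
    rw [hk] at hit
    rw [hit] at hchild
    have hne : T.parent^[k] s.1 ≠ r.1 := by
      intro he
      cases k with
      | zero => exact hsr (Subtype.ext he)
      | succ k =>
        have hdesc := T.isChild_iterate_parent (show k < T.depthOf s.1 by omega)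
        rw [he] at hdesc
        exact r.2 _ hdesc
    refine mul_eq_zero_of_right _ (Finset.prod_eq_zero
      (Finset.mem_range.2 (show k < T.depthOf s.1 - T.depthOf v by omega)) ?_)
    exact hyz _ (T.mem_outLabels.2 ⟨_, hchild, rfl⟩) fun he =>
      hne ((T.label_eq_iff hchild hrv).1 he)

end StagedTree
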